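/- arXiv:1404.4999 — 3 statements merged into one kernel-verified Lean document; each statement's English description precedes it below -/
import Mathlib

section
/- The ideal class group of the ring of integers of the real quadratic field ℚ(√58) is isomorphic to ℤ/2ℤ, and the ideal class group of the ring of integers of the imaginary quadratic field ℚ(√-58) is also isomorphic to ℤ/2ℤ. -/
open NumberField IntermediateField Polynomial

/-- `√n` is integral over `ℚ`. -/
theorem sqrtNat_isIntegral (n : ℕ) : IsIntegral ℚ (Real.sqrt n) := by
  refine ⟨X ^ 2 - C (n : ℚ), by monicity!, ?_⟩
  simp [Real.sq_sqrt (by positivity : (0:ℝ) ≤ (n:ℝ))]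

/-- `√(-n) = √n · i` is integral over `ℚ`. -/
theorem sqrtNegNat_isIntegral (n : ℕ) :
    IsIntegral ℚ ((Real.sqrt n : ℂ) * Complex.I) := by
  refine ⟨X ^ 2 + C (n : ℚ), by monicity!, ?_⟩
  have h : ((Real.sqrt n : ℝ) : ℂ) ^ 2 = (n : ℂ) := by
    rw [← Complex.ofReal_pow, Real.sq_sqrt (by positivity : (0:ℝ) ≤ (n:ℝ))]
    simp
  simp [mul_pow, Complex.I_sq, h]

/-- The real quadratic field `ℚ(√n)` is a number field. -/
instance (n : ℕ) : NumberField ℚ⟮Real.sqrt n⟯ :=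
  { to_charZero := inferInstance
    to_finiteDimensional := IntermediateField.adjoin.finiteDimensional (sqrtNat_isIntegral n) }

/-- The imaginary quadratic field `ℚ(√-n)` is a number field. -/
instance (n : ℕ) : NumberField ℚ⟮(Real.sqrt n : ℂ) * Complex.I⟯ :=
  { to_charZero := inferInstance
    to_finiteDimensional :=
      IntermediateField.adjoin.finiteDimensional (sqrtNegNat_isIntegral n) }

section QuadraticIdeals

variable {R : Type*} [CommRing R]

theorem Ideal.intCast_dvd_of_mem {P : Ideal R} (hP : P ≠ ⊤) {p : ℕ} (hp : p.Prime)
    (hpP : (p : R) ∈ P) {n : ℤ} (hn : (n : R) ∈ P) : (p : ℤ) ∣ n := by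
  by_contra h
  obtain ⟨u, v, huv⟩ := ((Nat.prime_iff_prime_int.mp hp).coprime_iff_not_dvd).mpr h
  apply hP
  rw [Ideal.eq_top_iff_one]
  have h1 : (1 : R) = u * p + v * n := by exact_mod_cast congrArg (Int.cast : ℤ → R) huv.symm
  rw [h1]
  exact P.add_mem (P.mul_mem_left _ hpP) (P.mul_mem_left _ hn)

theorem Ideal.eq_span_pair_of_sub_mem {θ : R} (hspan : ∀ x : R, ∃ a b : ℤ, x = a + b * θ)
    {P : Ideal R} (hP : P ≠ ⊤) {p : ℕ} (hp : p.Prime) (hpP : (p : R) ∈ P) {r : ℤ}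
    (hr : θ - r ∈ P) : P = Ideal.span {(p : R), θ - r} := by
  refine le_antisymm (fun x hx ↦ ?_) (Ideal.span_le.mpr (by rintro x (rfl | rfl) <;> assumption))
  obtain ⟨a, b, rfl⟩ := hspan x
  have h : ((a + b * r : ℤ) : R) ∈ P := by
    have := P.sub_mem hx (P.mul_mem_left (b : R) hr)
    convert this using 1
    push_cast
    ring
  obtain ⟨k, hk⟩ := Ideal.intCast_dvd_of_mem hP hp hpP h
  have hk' : (a : R) + b * r = p * k := by exact_mod_cast congrArg (Int.cast : ℤ → R) hk
  rw [Ideal.mem_span_pair]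
  exact ⟨k, b, by linear_combination -hk'⟩

theorem Ideal.eq_span_natCast_of_inert {θ : R} {d : ℤ} (hθ : θ ^ 2 = d)
    (hspan : ∀ x : R, ∃ a b : ℤ, x = a + b * θ) {P : Ideal R} (hP : P ≠ ⊤) {p : ℕ}
    (hp : p.Prime) (hpP : (p : R) ∈ P)
    (hd : ∀ a b : ZMod p, a ^ 2 - d * b ^ 2 = 0 → a = 0 ∧ b = 0) :
    P = Ideal.span {(p : R)} := by
  refine le_antisymm (fun x hx ↦ ?_) (Ideal.span_le.mpr (by simpa using hpP))
  obtain ⟨a, b, rfl⟩ := hspan x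
  have h : ((a ^ 2 - d * b ^ 2 : ℤ) : R) ∈ P := by
    convert P.mul_mem_left ((a : R) - b * θ) hx using 1
    push_cast
    linear_combination (b : R) ^ 2 * hθ
  have h1 := (ZMod.intCast_zmod_eq_zero_iff_dvd _ p).mpr (Ideal.intCast_dvd_of_mem hP hp hpP h)
  push_cast at h1
  obtain ⟨ha, hb⟩ := hd _ _ h1
  rw [ZMod.intCast_zmod_eq_zero_iff_dvd] at ha hb
  obtain ⟨k, rfl⟩ := ha
  obtain ⟨l, rfl⟩ := hb
  rw [Ideal.mem_span_singleton]
  exact ⟨k + l * θ, by push_cast; ring⟩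

theorem Ideal.IsPrime.sub_mem_or_add_mem {θ : R} {d : ℤ} (hθ : θ ^ 2 = d) {P : Ideal R}
    (hP : P.IsPrime) {p : ℕ} (hpP : (p : R) ∈ P) {r : ℤ} (hr : (p : ℤ) ∣ d - r ^ 2) :
    θ - r ∈ P ∨ θ - (-r : ℤ) ∈ P := by
  obtain ⟨k, hk⟩ := hr
  have hk' : (d : R) - r ^ 2 = p * k := by exact_mod_cast congrArg (Int.cast : ℤ → R) hk
  apply hP.mem_or_mem
  convert P.mul_mem_left (k : R) hpP using 1
  push_cast
  linear_combination hθ + hk'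

theorem Ideal.span_pair_mul_span_pair_eq_singleton {w x y z g : R} (h₁ : g ∣ w * y)
    (h₂ : g ∣ w * z) (h₃ : g ∣ x * y) (h₄ : g ∣ x * z)
    (hg : ∃ a b c e : R, a * (w * y) + b * (w * z) + c * (x * y) + e * (x * z) = g) :
    Ideal.span {w, x} * Ideal.span {y, z} = Ideal.span {g} := by
  rw [Ideal.span_pair_mul_span_pair]
  apply le_antisymm
  · rw [Ideal.span_le]
    rintro _ (rfl | rfl | rfl | rfl) <;> rw [SetLike.mem_coe, Ideal.mem_span_singleton] <;>
      assumption
  · obtain ⟨a, b, c, e, rfl⟩ := hg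
    rw [Ideal.span_singleton_le_iff_mem]
    refine Ideal.add_mem _ (Ideal.add_mem _ (Ideal.add_mem _ ?_ ?_) ?_) ?_ <;>
      exact Ideal.mul_mem_left _ _ (Ideal.subset_span (by simp))

theorem Ideal.span_pair_eq_singleton {w x g : R} (h₁ : g ∣ w) (h₂ : g ∣ x)
    (hg : ∃ a b : R, a * w + b * x = g) : Ideal.span {w, x} = Ideal.span {g} := by
  apply le_antisymm
  · rw [Ideal.span_le]
    rintro _ (rfl | rfl) <;> rwa [SetLike.mem_coe, Ideal.mem_span_singleton]
  · rwa [Ideal.span_singleton_le_iff_mem, Ideal.mem_span_pair]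

theorem Ideal.span_two_mul_self {θ : R} {d : ℤ} (hθ : θ ^ 2 = d) (hd : d % 4 = 2) :
    Ideal.span {2, θ} * Ideal.span {2, θ} = Ideal.span {(2 : R)} := by
  obtain ⟨k, rfl⟩ : ∃ k, d = 4 * k + 2 := ⟨d / 4, by omega⟩
  push_cast at hθ
  refine Ideal.span_pair_mul_span_pair_eq_singleton ⟨2, rfl⟩ ⟨θ, rfl⟩ ⟨θ, by ring⟩
    ⟨2 * k + 1, by linear_combination hθ⟩ ⟨-k, 0, 0, 1, by linear_combination hθ⟩

theorem Ideal.not_isPrincipal_span_two {d : ℤ} (e : ℤ√d ≃+* R) (hd : d % 4 = 2)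
    (hd2 : ∀ a b : ℤ, a ^ 2 - d * b ^ 2 ≠ 2 ∧ a ^ 2 - d * b ^ 2 ≠ -2) :
    ¬ (Ideal.span {2, e Zsqrtd.sqrtd}).IsPrincipal := by
  have hθ : e Zsqrtd.sqrtd ^ 2 = d := by
    rw [← map_pow, pow_two, Zsqrtd.dmuld, map_intCast]
  rintro ⟨g, hg⟩
  obtain ⟨g, rfl⟩ := e.surjective g
  have hsq := Ideal.span_two_mul_self hθ hd
  rw [hg, Ideal.submodule_span_eq, Ideal.span_singleton_mul_span_singleton, ← map_mul,
    ← map_ofNat e 2] at hsq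
  have h1 : e (g * g) ∣ e 2 := by
    rw [← Ideal.mem_span_singleton, hsq]; exact Ideal.mem_span_singleton_self _
  have h2 : e 2 ∣ e (g * g) := by
    rw [← Ideal.mem_span_singleton, ← hsq]; exact Ideal.mem_span_singleton_self _
  rw [map_dvd_iff] at h1 h2
  have h4 : Zsqrtd.norm (2 : ℤ√d) = 2 ^ 2 := by
    have := Zsqrtd.norm_natCast (d := d) 2
    norm_num at this ⊢
    exact this
  have h1' := map_dvd (Zsqrtd.normMonoidHom (d := d)) h1
  have h2' := map_dvd (Zsqrtd.normMonoidHom (d := d)) h2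
  simp only [Zsqrtd.normMonoidHom, MonoidHom.coe_mk, OneHom.coe_mk, h4, Zsqrtd.norm_mul] at h1' h2'
  rw [← pow_two, Int.pow_dvd_pow_iff two_ne_zero] at h1' h2'
  have h5 := Int.natAbs_eq_of_dvd_dvd h1' h2'
  have h6 : g.norm = g.re ^ 2 - d * g.im ^ 2 := by rw [Zsqrtd.norm_def]; ring
  have := hd2 g.re g.im
  omega

theorem Ideal.IsPrime.isPrincipal_or_of_sq_eq_58 {θ : R} (hθ : θ ^ 2 = (58 : ℤ))
    (hspan : ∀ x : R, ∃ a b : ℤ, x = a + b * θ) {P : Ideal R} (hP : P.IsPrime) {p : ℕ}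
    (hp : p.Prime) (hp9 : p ≤ 9) (hpP : (p : R) ∈ P) :
    P.IsPrincipal ∨ (P * Ideal.span {2, θ}).IsPrincipal := by
  have h58 : θ ^ 2 = 58 := by exact_mod_cast hθ
  have hp2 := hp.two_le
  interval_cases p <;> try (exfalso; revert hp; decide)
  · right
    have h := Ideal.eq_span_pair_of_sub_mem hspan hP.ne_top hp hpP (r := 0) (by
      simpa using (hP.sub_mem_or_add_mem hθ hpP (r := 0) (by decide)))
    simp only [Nat.cast_ofNat, Int.cast_zero, sub_zero] at h
    rw [h, Ideal.span_two_mul_self hθ (by decide)]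
    exact ⟨_, rfl⟩
  · right
    rcases hP.sub_mem_or_add_mem hθ hpP (r := 1) (by decide) with h | h <;>
      rw [Ideal.eq_span_pair_of_sub_mem hspan hP.ne_top hp hpP h] <;>
      push_cast
    · refine ⟨8 + θ, Ideal.span_pair_mul_span_pair_eq_singleton ⟨8 - θ, ?_⟩ ⟨4 * θ - 29, ?_⟩
        ⟨3 * θ - 22, ?_⟩ ⟨87 - 11 * θ, ?_⟩ ⟨1, 1, -1, 0, ?_⟩⟩ <;> grind
    · refine ⟨8 - θ, Ideal.span_pair_mul_span_pair_eq_singleton ⟨8 + θ, ?_⟩ ⟨4 * θ + 29, ?_⟩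
        ⟨3 * θ + 22, ?_⟩ ⟨87 + 11 * θ, ?_⟩ ⟨1, -1, 1, 0, ?_⟩⟩ <;> grind
  · left
    exact ⟨_, Ideal.eq_span_natCast_of_inert hθ hspan hP.ne_top hp hpP (by decide)⟩
  · left
    rcases hP.sub_mem_or_add_mem hθ hpP (r := 3) (by decide) with h | h <;>
      rw [Ideal.eq_span_pair_of_sub_mem hspan hP.ne_top hp hpP h] <;>
      push_cast
    · refine ⟨15 + 2 * θ, Ideal.span_pair_eq_singleton ⟨2 * θ - 15, ?_⟩ ⟨23 - 3 * θ, ?_⟩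
        ⟨3, 2, ?_⟩⟩ <;> grind
    · refine ⟨15 - 2 * θ, Ideal.span_pair_eq_singleton ⟨-2 * θ - 15, ?_⟩ ⟨-23 - 3 * θ, ?_⟩
        ⟨3, -2, ?_⟩⟩ <;> grind

theorem Ideal.IsPrime.isPrincipal_or_of_sq_eq_neg_58 {θ : R} (hθ : θ ^ 2 = (-58 : ℤ))
    (hspan : ∀ x : R, ∃ a b : ℤ, x = a + b * θ) {P : Ideal R} (hP : P.IsPrime) {p : ℕ}
    (hp : p.Prime) (hp9 : p ≤ 9) (hpP : (p : R) ∈ P) :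
    P.IsPrincipal ∨ (P * Ideal.span {2, θ}).IsPrincipal := by
  have hp2 := hp.two_le
  interval_cases p <;> try (exfalso; revert hp; decide)
  · right
    have h := Ideal.eq_span_pair_of_sub_mem hspan hP.ne_top hp hpP (r := 0) (by
      simpa using (hP.sub_mem_or_add_mem hθ hpP (r := 0) (by decide)))
    simp only [Nat.cast_ofNat, Int.cast_zero, sub_zero] at h
    rw [h, Ideal.span_two_mul_self hθ (by decide)]
    exact ⟨_, rfl⟩
  all_goals
    left
    exact ⟨_, Ideal.eq_span_natCast_of_inert hθ hspan hP.ne_top hp hpP (by decide)⟩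

theorem Ideal.IsPrime.exists_prime_natCast_mem {P : Ideal R} (hP : P.IsPrime) {n : ℕ}
    (hn0 : n ≠ 0) (hn : (n : R) ∈ P) : ∃ p : ℕ, p.Prime ∧ p ≤ n ∧ (p : R) ∈ P := by
  rw [← Nat.prod_primeFactorsList hn0, Nat.cast_list_prod, ← Multiset.prod_coe,
    hP.multiset_prod_mem_iff_exists_mem] at hn
  obtain ⟨x, hx, hxP⟩ := hn
  rw [Multiset.mem_coe, List.mem_map] at hx
  obtain ⟨p, hp, rfl⟩ := hx
  exact ⟨p, Nat.prime_of_mem_primeFactorsList hp, Nat.le_of_mem_primeFactorsList hp, hxP⟩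

end QuadraticIdeals

section ClassGroup

variable {R : Type*} [CommRing R] [IsDedekindDomain R]

open scoped nonZeroDivisors

theorem ClassGroup.mk0_mem_of_forall_prime_dvd {H : Subgroup (ClassGroup R)} (I : Ideal R)
    (h : ∀ P (hP : P ∈ (Ideal R)⁰), P.IsPrime → P ∣ I → ClassGroup.mk0 ⟨P, hP⟩ ∈ H)
    (hI : I ∈ (Ideal R)⁰) : ClassGroup.mk0 ⟨I, hI⟩ ∈ H := by
  induction I using UniqueFactorizationMonoid.induction_on_prime with
  | h₁ => simp at hI
  | h₂ I hu =>
    rw [(ClassGroup.mk0_eq_one_iff hI).mpr]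
    · exact one_mem H
    · rw [Ideal.isUnit_iff.mp hu]
      exact top_isPrincipal
  | h₃ I P hI0 hP ih =>
    have hI' := mem_nonZeroDivisors_of_ne_zero hI0
    have hP' := mem_nonZeroDivisors_of_ne_zero hP.ne_zero
    have : (⟨P * I, hI⟩ : (Ideal R)⁰) = ⟨P, hP'⟩ * ⟨I, hI'⟩ := rfl
    rw [this, map_mul]
    exact mul_mem (h P hP' (Ideal.isPrime_of_prime hP) (dvd_mul_right P I))
      (ih (fun Q hQ hQp hQI ↦ h Q hQ hQp (hQI.mul_left P)) hI')

theorem ClassGroup.nonempty_mulEquiv_zmod_two [Module.Free ℤ R] {d : ℤ}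
    (e : ℤ√d ≃+* R) (hd : d % 4 = 2)
    (hd2 : ∀ a b : ℤ, a ^ 2 - d * b ^ 2 ≠ 2 ∧ a ^ 2 - d * b ^ 2 ≠ -2) {N : ℕ}
    (hN : ∀ C : ClassGroup R, ∃ I : (Ideal R)⁰, ClassGroup.mk0 I = C ∧
      Ideal.absNorm (I : Ideal R) ≤ N)
    (hprime : ∀ P : Ideal R, P.IsPrime → ∀ p : ℕ, p.Prime → p ≤ N → (p : R) ∈ P →
      P.IsPrincipal ∨ (P * Ideal.span {2, e Zsqrtd.sqrtd}).IsPrincipal)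
    (hfin : ∀ I : (Ideal R)⁰, Ideal.absNorm (I : Ideal R) ≠ 0) :
    Nonempty (ClassGroup R ≃* Multiplicative (ZMod 2)) := by
  have hθ : e Zsqrtd.sqrtd ^ 2 = d := by
    rw [← map_pow, pow_two, Zsqrtd.dmuld, map_intCast]
  set Q : Ideal R := Ideal.span {2, e Zsqrtd.sqrtd}
  have hQ1 : ¬ Q.IsPrincipal := Ideal.not_isPrincipal_span_two e hd hd2
  have hQ2 : Q * Q = Ideal.span {2} := Ideal.span_two_mul_self hθ hd
  have hQ0 : Q ∈ (Ideal R)⁰ := mem_nonZeroDivisors_of_ne_zero fun h ↦ hQ1 (h ▸ bot_isPrincipal)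
  have hmul : ∀ P (hP : P ∈ (Ideal R)⁰), (P * Q).IsPrincipal →
      ClassGroup.mk0 ⟨P, hP⟩ * ClassGroup.mk0 ⟨Q, hQ0⟩ = 1 := fun P hP h ↦ by
    rw [← map_mul]
    exact (ClassGroup.mk0_eq_one_iff (mul_mem hP hQ0)).mpr h
  set c := ClassGroup.mk0 ⟨Q, hQ0⟩
  have hc1 : c ≠ 1 := fun h ↦ hQ1 ((ClassGroup.mk0_eq_one_iff hQ0).mp h)
  have hc2 : c ^ 2 = 1 := by rw [pow_two]; exact hmul Q hQ0 (hQ2 ▸ ⟨2, rfl⟩)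
  have hgen : ∀ C, C ∈ Subgroup.zpowers c := fun C ↦ by
    obtain ⟨⟨I, hI⟩, rfl, hIN⟩ := hN C
    refine ClassGroup.mk0_mem_of_forall_prime_dvd I (fun P hP hPp hPI ↦ ?_) hI
    have hle : Ideal.absNorm P ≤ N :=
      (Nat.le_of_dvd (Nat.pos_of_ne_zero (hfin ⟨I, hI⟩))
        (Ideal.absNorm_dvd_absNorm_of_le (Ideal.le_of_dvd hPI))).trans hIN
    obtain ⟨p, hp, hpn, hpP⟩ := hPp.exists_prime_natCast_mem (hfin ⟨P, hP⟩) (Ideal.absNorm_mem P)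
    rcases hprime P hPp p hp (hpn.trans hle) hpP with h | h
    · rw [(ClassGroup.mk0_eq_one_iff hP).mpr h]
      exact one_mem _
    · rw [eq_inv_of_mul_eq_one_left (hmul P hP h)]
      exact inv_mem (Subgroup.mem_zpowers c)
  refine ⟨mulEquivOfPrimeCardEq (p := 2) ?_ (by simp)⟩
  rw [← orderOf_eq_card_of_forall_mem_zpowers hgen]
  exact orderOf_eq_prime hc2 hc1

end ClassGroup

section QuadraticField

variable {K : Type*} [Field K] [NumberField K]

theorem Rat.exists_intCast_of_isIntegral_cast {r : ℚ} (h : IsIntegral ℤ (r : K)) :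
    ∃ n : ℤ, (n : ℚ) = r := by
  have h' : IsIntegral ℤ r := by
    rw [← isIntegral_algebraMap_iff (algebraMap ℚ K).injective]
    simpa using h
  simpa using IsIntegrallyClosed.isIntegral_iff.mp h'

theorem Rat.exists_intCast_of_sq_mul_squarefree {d n : ℤ} (hd : Squarefree d) {r : ℚ}
    (h : r ^ 2 * d = n) : ∃ m : ℤ, (m : ℚ) = r := by
  have hden : (r.den : ℚ) ≠ 0 := by exact_mod_cast r.den_ne_zero
  have h1 : r.num ^ 2 * d = n * (r.den : ℤ) ^ 2 := by
    have h2 : r = r.num / r.den := (Rat.num_div_den r).symm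
    rw [h2] at h
    field_simp at h
    rw [mul_comm (n : ℤ)]
    exact_mod_cast h
  have h3 : IsCoprime ((r.den : ℤ) ^ 2) (r.num ^ 2) :=
    (Int.isCoprime_iff_gcd_eq_one.mpr (by
      simpa [Int.gcd, Nat.coprime_comm] using r.reduced)).pow
  have h4 : (r.den : ℤ) ^ 2 ∣ d := h3.dvd_of_dvd_mul_left ⟨n, by linarith⟩
  have h5 := hd _ ((pow_two (r.den : ℤ)) ▸ h4)
  have h6 : r.den = 1 := by simpa using Int.isUnit_iff_natAbs_eq.mp h5
  exact ⟨r.num, Rat.coe_int_num_of_den_eq_one h6⟩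

theorem linearIndependent_one_sqrt {θ : K} {d : ℤ} (hθ : θ ^ 2 = d) (hd : ¬ IsSquare d) :
    LinearIndependent ℚ ![1, θ] := by
  rw [LinearIndependent.pair_iff]
  intro s t h
  have ht : t = 0 := by
    by_contra ht
    apply hd
    rw [← Rat.isSquare_intCast_iff]
    refine ⟨s / t, ?_⟩
    have htK : (t : K) ≠ 0 := by exact_mod_cast ht
    have h1 : θ = -(s / t : K) := by
      rw [Algebra.smul_def, Algebra.smul_def] at h
      simp only [eq_ratCast, mul_one] at h
      field_simp
      linear_combination h
    have h2 : ((d : ℚ) : K) = ((s / t * (s / t) : ℚ) : K) := by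
      push_cast
      rw [← hθ, h1]
      ring
    exact_mod_cast h2
  subst ht
  simpa using h

/-- The basis `1, √d` of a quadratic field. -/
noncomputable def quadraticBasis {θ : K} {d : ℤ} (hθ : θ ^ 2 = d) (hd : ¬ IsSquare d)
    (hK : Module.finrank ℚ K = 2) : Module.Basis (Fin 2) ℚ K :=
  basisOfLinearIndependentOfCardEqFinrank (linearIndependent_one_sqrt hθ hd) (by simp [hK])

theorem coe_quadraticBasis {θ : K} {d : ℤ} (hθ : θ ^ 2 = d) (hd : ¬ IsSquare d)
    (hK : Module.finrank ℚ K = 2) : ⇑(quadraticBasis hθ hd hK) = ![1, θ] :=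
  coe_basisOfLinearIndependentOfCardEqFinrank _ _

theorem exists_eq_add_mul_sqrt {θ : K} {d : ℤ} (hθ : θ ^ 2 = d) (hd : ¬ IsSquare d)
    (hK : Module.finrank ℚ K = 2) (x : K) : ∃ p q : ℚ, x = p + q * θ := by
  refine ⟨(quadraticBasis hθ hd hK).repr x 0, (quadraticBasis hθ hd hK).repr x 1, ?_⟩
  conv_lhs => rw [← (quadraticBasis hθ hd hK).sum_repr x]
  simp [coe_quadraticBasis, Fin.sum_univ_two, Algebra.smul_def]

theorem trace_sqrt {θ : K} {d : ℤ} (hθ : θ ^ 2 = d) (hd : ¬ IsSquare d)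
    (hK : Module.finrank ℚ K = 2) : Algebra.trace ℚ K θ = 0 := by
  set b := quadraticBasis hθ hd hK
  have hb0 : b 0 = 1 := by simp [b, coe_quadraticBasis]
  have hb1 : b 1 = θ := by simp [b, coe_quadraticBasis]
  have h0 : θ * b 0 = b 1 := by rw [hb0, hb1, mul_one]
  have h1 : θ * b 1 = (d : ℚ) • b 0 := by
    rw [hb0, hb1, ← pow_two, hθ, Algebra.smul_def]; simp
  rw [Algebra.trace_eq_matrix_trace b, Matrix.trace_fin_two, Algebra.leftMulMatrix_eq_repr_mul,
    Algebra.leftMulMatrix_eq_repr_mul, h0, h1]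
  simp

theorem trace_add_mul_sqrt {θ : K} {d : ℤ} (hθ : θ ^ 2 = d) (hd : ¬ IsSquare d)
    (hK : Module.finrank ℚ K = 2) (p q : ℚ) : Algebra.trace ℚ K (p + q * θ) = 2 * p := by
  have h1 : (p : K) = algebraMap ℚ K p := by simp
  have h2 : (q : K) * θ = q • θ := by rw [Algebra.smul_def]; simp
  rw [map_add, h1, h2, map_smul, trace_sqrt hθ hd hK, Algebra.trace_algebraMap, hK]
  simp

theorem exists_eq_add_mul_sqrt_of_isIntegral {θ : K} {d : ℤ} (hθ : θ ^ 2 = d)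
    (hsf : Squarefree d) (hd4 : d % 4 = 2) (hK : Module.finrank ℚ K = 2) {x : K}
    (hx : IsIntegral ℤ x) (hd : ¬ IsSquare d) : ∃ a b : ℤ, x = a + b * θ := by
  obtain ⟨p, q, rfl⟩ := exists_eq_add_mul_sqrt hθ hd hK x
  have htr := Algebra.isIntegral_trace (L := ℚ) hx
  rw [trace_add_mul_sqrt hθ hd hK] at htr
  obtain ⟨A, hA⟩ : ∃ A : ℤ, (A : ℚ) = 2 * p := by
    simpa using IsIntegrallyClosed.isIntegral_iff.mp htr
  have hAK : (A : K) = 2 * p := by exact_mod_cast congrArg (Rat.cast : ℚ → K) hA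
  have h_int (n : ℤ) : IsIntegral ℤ (n : K) := isIntegral_algebraMap (x := n)
  obtain ⟨n, hn⟩ : ∃ n : ℤ, (n : ℚ) = (2 * q) ^ 2 * d := by
    apply Rat.exists_intCast_of_isIntegral_cast (K := K)
    have h : (((2 * q) ^ 2 * d : ℚ) : K) = (((2 : ℤ) : K) * (p + q * θ) - A) ^ 2 := by
      push_cast
      rw [hAK, ← hθ]
      ring
    rw [h]
    exact (((h_int 2).mul hx).sub (h_int A)).pow 2
  obtain ⟨B, hB⟩ := Rat.exists_intCast_of_sq_mul_squarefree hsf hn.symm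
  have hBK : (B : K) = 2 * q := by exact_mod_cast congrArg (Rat.cast : ℚ → K) hB
  obtain ⟨m, hm⟩ : ∃ m : ℤ, (m : ℚ) = d * q ^ 2 - p ^ 2 := by
    apply Rat.exists_intCast_of_isIntegral_cast (K := K)
    have h : ((d * q ^ 2 - p ^ 2 : ℚ) : K) = (p + q * θ) ^ 2 - A * (p + q * θ) := by
      push_cast
      rw [hAK, ← hθ]
      ring
    rw [h]
    exact (hx.pow 2).sub ((h_int A).mul hx)
  have hm' : 4 * m = d * B ^ 2 - A ^ 2 := by
    have : (4 * m : ℚ) = d * B ^ 2 - A ^ 2 := by rw [hm, hA, hB]; ring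
    exact_mod_cast this
  obtain ⟨k, rfl⟩ : ∃ k, d = 4 * k + 2 := ⟨d / 4, by omega⟩
  have hAe : Even A := by
    rw [← Int.even_pow' two_ne_zero]
    exact ⟨(2 * k + 1) * B ^ 2 - 2 * m, by linarith⟩
  obtain ⟨a, rfl⟩ := hAe
  have hBe : Even B := by
    rw [← Int.even_pow' two_ne_zero]
    exact ⟨m + a ^ 2 - k * B ^ 2, by linarith⟩
  obtain ⟨b, rfl⟩ := hBe
  refine ⟨a, b, ?_⟩
  push_cast at hAK hBK
  have h2 : (2 : K) ≠ 0 := two_ne_zero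
  have hp : (p : K) = a := mul_left_cancel₀ h2 (by linear_combination -hAK)
  have hq : (q : K) = b := mul_left_cancel₀ h2 (by linear_combination -hBK)
  rw [hp, hq]

theorem exists_zsqrtd_equiv {θ : K} {d : ℤ} (hθ : θ ^ 2 = d)
    (hsf : Squarefree d) (hd4 : d % 4 = 2) (hK : Module.finrank ℚ K = 2)
    (hd : ¬ IsSquare d) : ∃ e : ℤ√d ≃+* 𝓞 K, (e Zsqrtd.sqrtd : K) = θ := by
  have h_int : IsIntegral ℤ θ := IsIntegral.of_pow two_pos (hθ ▸ isIntegral_algebraMap (x := d))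
  let r : 𝓞 K := ⟨θ, h_int⟩
  have hr : r * r = (d : 𝓞 K) := by
    apply FaithfulSMul.algebraMap_injective (𝓞 K) K
    rw [map_mul, map_intCast, ← hθ, pow_two]
    rfl
  have hinj := Zsqrtd.lift_injective ⟨r, hr⟩ fun n hn ↦ hd ⟨n, hn⟩
  have hsurj : Function.Surjective (Zsqrtd.lift ⟨r, hr⟩) := fun x ↦ by
    obtain ⟨a, b, hab⟩ := exists_eq_add_mul_sqrt_of_isIntegral hθ hsf hd4 hK x.isIntegral_coe hd
    refine ⟨⟨a, b⟩, ?_⟩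
    apply FaithfulSMul.algebraMap_injective (𝓞 K) K
    rw [hab, Zsqrtd.lift_apply_apply, map_add, map_mul, map_intCast, map_intCast]
    rfl
  refine ⟨RingEquiv.ofBijective _ ⟨hinj, hsurj⟩, ?_⟩
  have h : Zsqrtd.lift ⟨r, hr⟩ Zsqrtd.sqrtd = r := by simp
  exact congrArg (algebraMap (𝓞 K) K) h

theorem discr_eq_four_mul {θ : K} {d : ℤ} (hθ : θ ^ 2 = d)
    (hsf : Squarefree d) (hd4 : d % 4 = 2) (hK : Module.finrank ℚ K = 2)
    (hd : ¬ IsSquare d) : discr K = 4 * d := by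
  obtain ⟨e, he⟩ := exists_zsqrtd_equiv hθ hsf hd4 hK hd
  set r := e Zsqrtd.sqrtd
  have hli : LinearIndependent ℤ ![1, r] := by
    rw [LinearIndependent.pair_iff]
    intro s t h
    have h1 : e ⟨s, t⟩ = 0 := by
      rw [← h, Zsqrtd.decompose]
      simp [r, mul_comm]
    rw [map_eq_zero_iff e e.injective] at h1
    exact ⟨congrArg Zsqrtd.re h1, congrArg Zsqrtd.im h1⟩
  have hsp : ⊤ ≤ Submodule.span ℤ (Set.range ![1, r]) := by
    rintro x -
    obtain ⟨⟨a, b⟩, rfl⟩ := e.surjective x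
    rw [Matrix.range_cons, Matrix.range_cons, Matrix.range_empty, Set.union_empty,
      Set.singleton_union, Submodule.mem_span_pair]
    exact ⟨a, b, by rw [Zsqrtd.decompose]; simp [r, mul_comm]⟩
  rw [← discr_eq_discr K (Module.Basis.mk hli hsp), Algebra.discr_def, Matrix.det_fin_two]
  have h1 : Algebra.trace ℤ (𝓞 K) 1 = 2 := by
    have := Algebra.coe_trace_int (K := K) 1
    have h2 := trace_add_mul_sqrt hθ hd hK 1 0
    norm_num at this h2
    rw [h2] at this
    exact_mod_cast this
  have h2 : Algebra.trace ℤ (𝓞 K) r = 0 := by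
    have := Algebra.coe_trace_int (K := K) r
    rw [he, trace_sqrt hθ hd hK] at this
    exact_mod_cast this
  have h3 : Algebra.trace ℤ (𝓞 K) (r * r) = 2 * d := by
    have := Algebra.coe_trace_int (K := K) (r * r)
    have h3 := trace_add_mul_sqrt hθ hd hK d 0
    have hrr : ((r * r : 𝓞 K) : K) = d := by
      rw [← hθ, pow_two, ← he]
      rfl
    rw [hrr] at this
    norm_num at h3
    rw [h3] at this
    exact_mod_cast this
  simp [Algebra.traceMatrix_apply, Algebra.traceForm_apply, h1, h2, h3]
  ring

theorem exists_absNorm_le_nine (hK : Module.finrank ℚ K = 2) (hdisc : |discr K| = 232)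
    (C : ClassGroup (𝓞 K)) :
    ∃ I : nonZeroDivisors (Ideal (𝓞 K)), ClassGroup.mk0 I = C ∧
      Ideal.absNorm (I : Ideal (𝓞 K)) ≤ 9 := by
  obtain ⟨I, hI, hle⟩ := exists_ideal_in_class_of_norm_le C
  refine ⟨I, hI, ?_⟩
  have hr := InfinitePlace.card_add_two_mul_card_eq_rank K
  rw [hK] at hr hle
  rw [← Int.cast_abs, hdisc] at hle
  have hc : InfinitePlace.nrComplexPlaces K ≤ 1 := by omega
  have hpi := Real.pi_gt_d2
  have h4 : 4 / Real.pi ≤ 4 / 3.14 := by gcongr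
  have h1 : (1 : ℝ) ≤ 4 / Real.pi := by
    rw [one_le_div Real.pi_pos]; exact Real.pi_le_four
  have h2 : (4 / Real.pi) ^ InfinitePlace.nrComplexPlaces K ≤ 4 / 3.14 := by
    refine (pow_le_pow_right₀ h1 hc).trans ?_
    rwa [pow_one]
  have h3 : √((232 : ℤ) : ℝ) ≤ 15.24 := by
    rw [Real.sqrt_le_left (by norm_num)]; norm_num
  have h5 : (4 / Real.pi) ^ InfinitePlace.nrComplexPlaces K *
      (((2 : ℕ).factorial : ℝ) / ((2 : ℕ) : ℝ) ^ 2 * √((232 : ℤ) : ℝ)) ≤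
      4 / 3.14 * (1 / 2 * 15.24) := by
    have h6 : ((2 : ℕ).factorial : ℝ) / ((2 : ℕ) : ℝ) ^ 2 = 1 / 2 := by norm_num [Nat.factorial]
    rw [h6]
    gcongr
  have h6 : (Ideal.absNorm (I : Ideal (𝓞 K)) : ℝ) < 10 :=
    (hle.trans h5).trans_lt (by norm_num)
  have : Ideal.absNorm (I : Ideal (𝓞 K)) < 10 := by exact_mod_cast h6
  omega

theorem finrank_adjoin_sqrt {L : Type*} [Field L] [Algebra ℚ L] {α : L} {d : ℤ}
    (hα : α ^ 2 = d) (hd : ¬ IsSquare d) : Module.finrank ℚ ℚ⟮α⟯ = 2 := by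
  have hirr : Irreducible (X ^ 2 - C (d : ℚ)) := by
    rw [X_pow_sub_C_irreducible_iff_of_prime Nat.prime_two]
    rintro b hb
    exact hd (Rat.isSquare_intCast_iff.mp ⟨b, by rw [← hb, pow_two]⟩)
  have hmin := minpoly.eq_of_irreducible_of_monic hirr (x := α) (by
    rw [aeval_def, eval₂_sub, eval₂_X_pow, eval₂_C, hα, map_intCast, sub_self])
    (monic_X_pow_sub_C _ two_ne_zero)
  have h_int : IsIntegral ℚ α :=
    ⟨X ^ 2 - C (d : ℚ), monic_X_pow_sub_C _ two_ne_zero, by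
      rw [eval₂_sub, eval₂_X_pow, eval₂_C, hα, map_intCast, sub_self]⟩
  rw [adjoin.finrank h_int, ← hmin, natDegree_X_pow_sub_C]

theorem classGroup_of_sq_eq {L : Type*} [Field L] [CharZero L] {α : L} [NumberField ℚ⟮α⟯]
    {d : ℤ} (hα : α ^ 2 = d) (hd : d = 58 ∨ d = -58) :
    Nonempty (ClassGroup (𝓞 ℚ⟮α⟯) ≃* Multiplicative (ZMod 2)) := by
  have hsf : Squarefree d := by
    rw [← Int.squarefree_natAbs]
    have : Squarefree (2 * 29) := by
      rw [Nat.squarefree_mul (by norm_num)]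
      exact ⟨Nat.prime_two.prime.squarefree,
        (by norm_num : Nat.Prime 29).prime.squarefree⟩
    rcases hd with rfl | rfl <;> exact this
  have hd4 : d % 4 = 2 := by rcases hd with rfl | rfl <;> rfl
  have hsq : ¬ IsSquare d := by
    rintro ⟨n, hn⟩
    have := hsf n ⟨1, by rw [hn, mul_one]⟩
    rcases Int.isUnit_iff.mp this with rfl | rfl <;> omega
  have hK := finrank_adjoin_sqrt hα hsq
  have hθ : (AdjoinSimple.gen ℚ α) ^ 2 = d := by
    ext
    simpa using hα
  obtain ⟨e, -⟩ := exists_zsqrtd_equiv hθ hsf hd4 hK hsq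
  have hdisc : |discr ℚ⟮α⟯| = 232 := by
    rw [discr_eq_four_mul hθ hsf hd4 hK hsq]
    rcases hd with rfl | rfl <;> rfl
  have he : e Zsqrtd.sqrtd ^ 2 = d := by
    rw [← map_pow, pow_two, Zsqrtd.dmuld, map_intCast]
  have hspan : ∀ x, ∃ a b : ℤ, x = a + b * e Zsqrtd.sqrtd := fun x ↦ by
    obtain ⟨⟨a, b⟩, rfl⟩ := e.surjective x
    exact ⟨a, b, by rw [Zsqrtd.decompose]; simp [mul_comm]⟩
  refine ClassGroup.nonempty_mulEquiv_zmod_two e hd4 (fun a b ↦ ?_)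
    (exists_absNorm_le_nine hK hdisc) (fun P hP p hp hp9 hpP ↦ ?_)
    Ideal.absNorm_ne_zero_of_nonZeroDivisors
  · have key : ∀ a : ZMod 29, a ^ 2 ≠ 2 ∧ a ^ 2 ≠ -2 := by decide
    have hd29 : (d : ZMod 29) = 0 := by rcases hd with rfl | rfl <;> rfl
    constructor <;> intro h <;> replace h := congrArg (Int.cast : ℤ → ZMod 29) h <;>
      push_cast at h <;> rw [hd29, zero_mul, sub_zero] at h
    · exact (key a).1 h
    · exact (key a).2 h
  · rcases hd with rfl | rfl
    · exact hP.isPrincipal_or_of_sq_eq_58 he hspan hp hp9 hpP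
    · exact hP.isPrincipal_or_of_sq_eq_neg_58 he hspan hp hp9 hpP

end QuadraticField

/-- The ideal class group of the ring of integers of `ℚ(√58)` is isomorphic to
`ℤ/2ℤ`, and the ideal class group of the ring of integers of `ℚ(√-58)` is also
isomorphic to `ℤ/2ℤ`. -/
theorem classGroup_sqrt58_and_sqrt_neg58 :
    Nonempty (ClassGroup (𝓞 ℚ⟮Real.sqrt (58 : ℕ)⟯) ≃* Multiplicative (ZMod 2)) ∧
    Nonempty (ClassGroup (𝓞 ℚ⟮(Real.sqrt (58 : ℕ) : ℂ) * Complex.I⟯) ≃*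
      Multiplicative (ZMod 2)) := by
  refine ⟨classGroup_of_sq_eq (d := 58) ?_ (Or.inl rfl),
    classGroup_of_sq_eq (d := -58) ?_ (Or.inr rfl)⟩
  · rw [Real.sq_sqrt (by positivity)]
    norm_num
  · rw [mul_pow, Complex.I_sq, ← Complex.ofReal_pow, Real.sq_sqrt (by positivity)]
    norm_num
end

section
/- The ideal class group of the ring of integers of the real quadratic field ℚ(√82) is isomorphic to ℤ/4ℤ, and the ideal class group of the ring of integers of the imaginary quadratic field ℚ(√-82) is also isomorphic to ℤ/4ℤ. -/
open NumberField IntermediateField Polynomial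

section QuadraticOrder

theorem sq_ne_of_emod_four {d : ℤ} (hd : d % 4 = 2) (b : ℤ) : b ^ 2 ≠ d := by
  rintro rfl
  rcases Int.even_or_odd' b with ⟨k, rfl | rfl⟩ <;> ring_nf at hd <;> omega

variable {R : Type*} [CommRing R]

/-- The ideal `(a, b + θ)`. -/
def quadIdeal (θ : R) (a b : ℤ) : Ideal R := Ideal.span {(a : R), (b : R) + θ}

theorem quadIdeal_congr (θ : R) {a b b' : ℤ} (h : a ∣ b' - b) :
    quadIdeal θ a b' = quadIdeal θ a b := by
  apply le_antisymm <;> rw [quadIdeal, Ideal.span_le, Set.insert_subset_iff,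
    Set.singleton_subset_iff] <;> obtain ⟨k, hk⟩ := h <;> refine ⟨?_, ?_⟩
  · exact Ideal.subset_span (by simp)
  · refine Ideal.mem_span_pair.2 ⟨k, 1, ?_⟩
    have : (b' : R) - b = a * k := by exact_mod_cast congrArg (Int.cast : ℤ → R) hk
    linear_combination -this
  · exact Ideal.subset_span (by simp)
  · refine Ideal.mem_span_pair.2 ⟨-k, 1, ?_⟩
    have : (b' : R) - b = a * k := by exact_mod_cast congrArg (Int.cast : ℤ → R) hk
    linear_combination this

theorem quadIdeal_neg (θ : R) (a b : ℤ) : quadIdeal θ (-a) b = quadIdeal θ a b := by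
  simp [quadIdeal, Ideal.span_insert, Ideal.span_singleton_neg]

theorem quadIdeal_mul {θ : R} {d : ℤ} (hθ : θ ^ 2 = d) {a a' b : ℤ} (h : a * a' ∣ b ^ 2 - d)
    (hc : ∃ u v w : ℤ, u * a + v * a' + w * (2 * b) = 1) :
    quadIdeal θ a b * quadIdeal θ a' b = quadIdeal θ (a * a') b := by
  obtain ⟨k, hk⟩ := h
  have hk' : (b : R) ^ 2 - d = a * a' * k := by exact_mod_cast congrArg (Int.cast : ℤ → R) hk
  obtain ⟨u, v, w, huv⟩ := hc
  have huv' : (u : R) * a + v * a' + w * (2 * b) = 1 := by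
    exact_mod_cast congrArg (Int.cast : ℤ → R) huv
  unfold quadIdeal
  rw [Ideal.span_pair_mul_span_pair]
  apply le_antisymm
  · rw [Ideal.span_le]
    rintro x (rfl | rfl | rfl | rfl) <;> refine Ideal.mem_span_pair.2 ?_
    · exact ⟨1, 0, by push_cast; ring⟩
    · exact ⟨0, a, by ring⟩
    · exact ⟨0, a', by ring⟩
    · exact ⟨-k, 2 * b, by push_cast; linear_combination hk' - hθ⟩
  · rw [Ideal.span_le]
    rintro x (rfl | rfl)
    · exact Ideal.subset_span (by simp)
    · have key : (b : R) + θ = u * (a * (b + θ)) + v * (((b : R) + θ) * a')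
          + w * (((b : R) + θ) * (b + θ)) + (w * k) * (a * a') := by
        linear_combination (-(b : R) - θ) * huv' - w * hθ + w * hk'
      generalize hI : Ideal.span {(a : R) * a', a * (b + θ), (b + θ) * a', (b + θ) * (b + θ)} = I
      rw [key, SetLike.mem_coe]
      refine I.add_mem (I.add_mem (I.add_mem ?_ ?_) ?_) ?_ <;>
        exact I.mul_mem_left _ (hI ▸ Ideal.subset_span (by simp))

theorem span_mul_quadIdeal {θ : R} {d : ℤ} (hθ : θ ^ 2 = d) {a b c : ℤ} (h : a * c = b ^ 2 - d) :
    Ideal.span {(b : R) - θ} * quadIdeal θ a b = Ideal.span {(a : R)} * quadIdeal θ c (-b) := by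
  have h' : (a : R) * c = b ^ 2 - d := by exact_mod_cast congrArg (Int.cast : ℤ → R) h
  have e1 : ((b : R) - θ) * (b + θ) = a * c := by linear_combination -h' - hθ
  have e2 : (a : R) * (((-b : ℤ) : R) + θ) = -(((b : R) - θ) * a) := by push_cast; ring
  unfold quadIdeal
  rw [Ideal.span_insert, Ideal.span_insert, Ideal.mul_sup, Ideal.mul_sup,
    Ideal.span_singleton_mul_span_singleton, Ideal.span_singleton_mul_span_singleton,
    Ideal.span_singleton_mul_span_singleton, Ideal.span_singleton_mul_span_singleton,
    e1, e2, Ideal.span_singleton_neg, sup_comm]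

theorem quadIdeal_eq_span {θ : R} {d : ℤ} (hθ : θ ^ 2 = d) (b : ℤ) :
    quadIdeal θ (b ^ 2 - d) b = Ideal.span {(b : R) + θ} := by
  refine Ideal.span_pair_eq_span_right_iff_dvd.2 ⟨b - θ, ?_⟩
  push_cast
  linear_combination hθ

theorem quadIdeal_one (θ : R) (b : ℤ) : quadIdeal θ 1 b = ⊤ :=
  (Ideal.eq_top_iff_one _).2 (Ideal.subset_span (by simp))

/-- Every nonzero ideal of `ℤ[θ]` is an integer multiple of some `(a, b + θ)`. -/
theorem exists_eq_span_mul_quadIdeal {θ : R} {d : ℤ} (hθ : θ ^ 2 = d)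
    (hgen : ∀ x : R, ∃ a b : ℤ, x = a + b * θ) (hd : ∀ b : ℤ, b ^ 2 ≠ d)
    {J : Ideal R} (hJ : J ≠ ⊥) :
    ∃ n a b : ℤ, n ≠ 0 ∧ a ≠ 0 ∧ a ∣ b ^ 2 - d ∧
      J = Ideal.span {(n : R)} * quadIdeal θ a b := by
  let S : Ideal ℤ :=
    { carrier := {y | ∃ x : ℤ, (x : R) + y * θ ∈ J}
      add_mem' := by
        rintro y y' ⟨x, hx⟩ ⟨x', hx'⟩
        refine ⟨x + x', ?_⟩
        convert J.add_mem hx hx' using 1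
        push_cast; ring
      zero_mem' := ⟨0, by simp⟩
      smul_mem' := by
        rintro k y ⟨x, hx⟩
        refine ⟨k * x, ?_⟩
        convert J.mul_mem_left (k : R) hx using 1
        simp only [smul_eq_mul]; push_cast; ring }
  obtain ⟨n, hn⟩ := (IsPrincipalIdealRing.principal S).principal
  obtain ⟨m, hm⟩ := (IsPrincipalIdealRing.principal (J.comap (Int.castRingHom R))).principal
  have hS : ∀ x y : ℤ, (x : R) + y * θ ∈ J → n ∣ y := fun x y h ↦ by
    have : y ∈ S := ⟨x, h⟩
    rw [hn] at this
    exact Ideal.mem_span_singleton.1 this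
  have hT : ∀ x : ℤ, (x : R) ∈ J ↔ m ∣ x := fun x ↦ by
    rw [← Ideal.mem_span_singleton, ← Ideal.submodule_span_eq, ← hm]; simp
  have hθJ : ∀ x y : ℤ, (x : R) + y * θ ∈ J → ((y * d : ℤ) : R) + (x : ℤ) * θ ∈ J :=
    fun x y h ↦ by
      convert J.mul_mem_left θ h using 1
      push_cast; linear_combination -y * hθ
  obtain ⟨m₀, hm₀⟩ : n ∈ S := by rw [hn]; exact Ideal.mem_span_singleton_self n
  obtain ⟨b, rfl⟩ := hS _ _ (hθJ _ _ hm₀)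
  obtain ⟨a, rfl⟩ : n ∣ m := by
    refine hS 0 m ?_
    have := (hT m).2 dvd_rfl
    simpa [mul_comm] using J.mul_mem_left θ this
  have hdvd : n * a ∣ n * (b ^ 2 - d) := by
    rw [← hT]
    convert J.mul_mem_left ((b : R) - θ) hm₀ using 1
    push_cast; linear_combination n * hθ
  have hna : n * a ≠ 0 := by
    intro h0
    obtain ⟨z, hz, hz0⟩ := Submodule.exists_mem_ne_zero_of_ne_bot hJ
    obtain ⟨x, y, rfl⟩ := hgen z
    have h1 : (x ^ 2 - d * y ^ 2 : ℤ) = 0 := by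
      rw [← zero_dvd_iff, ← h0, ← hT]
      convert J.mul_mem_left ((x : R) - y * θ) hz using 1
      push_cast; linear_combination y ^ 2 * hθ
    have hy : y = 0 := by
      by_contra hy
      have : y ^ 2 ∣ x ^ 2 := ⟨d, by linear_combination h1⟩
      rw [Int.pow_dvd_pow_iff two_ne_zero] at this
      obtain ⟨t, rfl⟩ := this
      refine hd t (mul_left_cancel₀ (pow_ne_zero 2 hy) ?_)
      linear_combination h1
    subst hy
    have hx : x = 0 := by simpa using h1
    exact hz0 (by simp [hx])
  refine ⟨n, a, b, left_ne_zero_of_mul hna, right_ne_zero_of_mul hna,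
    (mul_dvd_mul_iff_left (left_ne_zero_of_mul hna)).1 hdvd, le_antisymm ?_ ?_⟩
  · intro z hz
    obtain ⟨x, y, rfl⟩ := hgen z
    obtain ⟨k, rfl⟩ := hS x y hz
    have : n * a ∣ x - k * (n * b) := by
      rw [← hT]
      convert J.sub_mem hz (J.mul_mem_left (k : R) hm₀) using 1
      push_cast; ring
    obtain ⟨l, hl⟩ := this
    refine Ideal.mem_span_singleton_mul.2 ⟨l * a + k * (b + θ),
      Ideal.mem_span_pair.2 ⟨l, k, rfl⟩, ?_⟩
    have hl' : (x : R) - k * (n * b) = n * a * l := by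
      exact_mod_cast congrArg (Int.cast : ℤ → R) hl
    push_cast
    linear_combination -hl'
  · rw [Ideal.mul_le]
    intro r hr s hs
    obtain ⟨t, rfl⟩ := Ideal.mem_span_singleton'.1 hr
    obtain ⟨u, v, rfl⟩ := Ideal.mem_span_pair.1 hs
    have h1 : ((n * a : ℤ) : R) ∈ J := (hT _).2 dvd_rfl
    convert J.add_mem (J.mul_mem_left (t * u) h1) (J.mul_mem_left (t * v) hm₀) using 1
    push_cast; ring

/-- A generator of `(2, θ)` would have norm `±2`. -/
theorem not_isPrincipal_quadIdeal_two {θ : R} {d : ℤ} (hθ : θ ^ 2 = d)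
    (hgen : ∀ x : R, ∃ a b : ℤ, x = a + b * θ)
    (hinj : ∀ a b : ℤ, (a : R) + b * θ = 0 → a = 0 ∧ b = 0) (hd : d % 4 = 2)
    (hnorm : ∀ x y : ℤ, (x ^ 2 - d * y ^ 2).natAbs ≠ 2) :
    ¬ (quadIdeal θ 2 0).IsPrincipal := by
  rintro ⟨α, hα⟩
  rw [Ideal.submodule_span_eq] at hα
  have hmul : ∀ x y z w s t : ℤ, (s : R) + t * θ = (x + y * θ) * (z + w * θ) →
      s = x * z + d * y * w ∧ t = x * w + y * z := by
    intro x y z w s t h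
    have := hinj (s - (x * z + d * y * w)) (t - (x * w + y * z)) (by
      push_cast; linear_combination h + y * w * hθ)
    constructor <;> linarith [this.1, this.2]
  have hαm : α ∈ quadIdeal θ 2 0 := hα ▸ Ideal.mem_span_singleton_self α
  obtain ⟨u, v, huv⟩ := Ideal.mem_span_pair.1 hαm
  obtain ⟨x, y, rfl⟩ := hgen α
  obtain ⟨u₀, u₁, rfl⟩ := hgen u
  obtain ⟨v₀, v₁, rfl⟩ := hgen v
  have hx := hinj (x - 2 * u₀ - d * v₁) (y - 2 * u₁ - v₀) (by
    push_cast at huv ⊢; linear_combination -huv + v₁ * hθ)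
  obtain ⟨p, hp⟩ : (x : R) + y * θ ∣ 2 := Ideal.mem_span_singleton.1 (hα ▸
    Ideal.subset_span (by simp))
  obtain ⟨q, hq⟩ : (x : R) + y * θ ∣ θ := Ideal.mem_span_singleton.1 (hα ▸
    Ideal.subset_span (by simp))
  obtain ⟨p₀, p₁, rfl⟩ := hgen p
  obtain ⟨q₀, q₁, rfl⟩ := hgen q
  obtain ⟨hp0, hp1⟩ := hmul x y p₀ p₁ 2 0 (by push_cast; linear_combination hp)
  obtain ⟨hq0, hq1⟩ := hmul x y q₀ q₁ 0 1 (by push_cast; linear_combination hq)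
  have h4 : x ^ 2 - d * y ^ 2 ∣ 4 := ⟨p₀ ^ 2 - d * p₁ ^ 2, by
    linear_combination (2 + (x * p₀ + d * y * p₁)) * hp0 - d * (x * p₁ + y * p₀) * hp1⟩
  have hdd : x ^ 2 - d * y ^ 2 ∣ -d := ⟨q₀ ^ 2 - d * q₁ ^ 2, by
    linear_combination (x * q₀ + d * y * q₁) * hq0 - d * (1 + (x * q₁ + y * q₀)) * hq1⟩
  have h2 : x ^ 2 - d * y ^ 2 ∣ 2 := by
    have : (2 : ℤ) = -d + 4 * ((d + 2) / 4) := by omega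
    rw [this]
    exact dvd_add hdd (h4.mul_right _)
  have heven : 2 ∣ x ^ 2 - d * y ^ 2 := by
    have hd2 : (2 : ℤ) ∣ d := by omega
    have hx2 : 2 ∣ x := by
      have : x = 2 * u₀ + d * v₁ := by linarith [hx.1]
      rw [this]
      exact dvd_add (dvd_mul_right _ _) (hd2.mul_right _)
    exact dvd_sub (dvd_pow hx2 two_ne_zero) (hd2.mul_right _)
  exact hnorm x y (Int.natAbs_eq_of_dvd_dvd h2 heven)


theorem quadIdeal_ne_bot [CharZero R] (θ : R) {a : ℤ} (ha : a ≠ 0) (b : ℤ) : quadIdeal θ a b ≠ ⊥ := by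
  intro h
  have : (a : R) ∈ quadIdeal θ a b := Ideal.subset_span (by simp)
  rw [h, Ideal.mem_bot] at this
  exact ha (by exact_mod_cast this)

variable [IsDedekindDomain R]

open scoped Classical in
/-- The class of a nonzero ideal; by convention the zero ideal has trivial class. -/
noncomputable def idealClass (J : Ideal R) : ClassGroup R :=
  if h : J = ⊥ then 1 else ClassGroup.mk0 ⟨J, mem_nonZeroDivisors_of_ne_zero h⟩

theorem idealClass_mul {I J : Ideal R} (hI : I ≠ ⊥) (hJ : J ≠ ⊥) :
    idealClass (I * J) = idealClass I * idealClass J := by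
  have hIJ : I * J ≠ ⊥ := mul_ne_zero hI hJ
  rw [idealClass, idealClass, idealClass, dif_neg hI, dif_neg hJ, dif_neg hIJ, ← map_mul]
  rfl

theorem idealClass_eq_one_iff {I : Ideal R} (hI : I ≠ ⊥) :
    idealClass I = 1 ↔ I.IsPrincipal := by
  rw [idealClass, dif_neg hI, ClassGroup.mk0_eq_one_iff]

theorem idealClass_span_singleton (x : R) : idealClass (Ideal.span {x}) = 1 := by
  by_cases hx : Ideal.span {x} = ⊥
  · rw [idealClass, dif_pos hx]
  · exact (idealClass_eq_one_iff hx).2 ⟨x, rfl⟩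

variable [CharZero R]

theorem idealClass_quadIdeal_mul {θ : R} {d : ℤ} (hθ : θ ^ 2 = d) {a a' b : ℤ} (ha : a ≠ 0)
    (ha' : a' ≠ 0) (h : a * a' ∣ b ^ 2 - d) (hc : ∃ u v w : ℤ, u * a + v * a' + w * (2 * b) = 1) :
    idealClass (quadIdeal θ (a * a') b) =
      idealClass (quadIdeal θ a b) * idealClass (quadIdeal θ a' b) := by
  rw [← quadIdeal_mul hθ h hc,
    idealClass_mul (quadIdeal_ne_bot θ ha b) (quadIdeal_ne_bot θ ha' b)]

theorem idealClass_quadIdeal_swap {θ : R} {d : ℤ} (hθ : θ ^ 2 = d) {a b c : ℤ} (ha : a ≠ 0)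
    (hc : c ≠ 0) (h : a * c = b ^ 2 - d) :
    idealClass (quadIdeal θ a b) = idealClass (quadIdeal θ c (-b)) := by
  have h1 := quadIdeal_ne_bot θ ha b
  have h2 := quadIdeal_ne_bot θ hc (-b)
  have h3 : Ideal.span {(a : R)} ≠ ⊥ := by simpa using ha
  have h4 := span_mul_quadIdeal hθ h
  have h5 : Ideal.span {(b : R) - θ} ≠ ⊥ := by
    intro h0
    rw [h0, Ideal.bot_mul] at h4
    exact mul_ne_zero h3 h2 h4.symm
  simpa [idealClass_mul, h1, h2, h3, h5, idealClass_span_singleton] using congrArg idealClass h4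

/-- Reduction theory: it suffices to treat the classes of reduced ideals `(a, b + θ)`. -/
theorem mem_of_forall_reduced {θ : R} {d : ℤ} (hθ : θ ^ 2 = d)
    (hgen : ∀ x : R, ∃ a b : ℤ, x = a + b * θ) (hd : ∀ b : ℤ, b ^ 2 ≠ d)
    {H : Subgroup (ClassGroup R)}
    (hred : ∀ a b : ℤ, 0 < a → 2 * |b| ≤ a → a ∣ b ^ 2 - d → a ^ 2 ≤ |b ^ 2 - d| →
      idealClass (quadIdeal θ a b) ∈ H) (C : ClassGroup R) : C ∈ H := by
  have key : ∀ (n : ℕ) (a b : ℤ), a.natAbs = n → a ≠ 0 → a ∣ b ^ 2 - d →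
      idealClass (quadIdeal θ a b) ∈ H := by
    intro n
    induction n using Nat.strong_induction_on with
    | _ n ih =>
      intro a b han ha hab
      wlog hpos : 0 < a generalizing a
      · rw [← quadIdeal_neg]
        exact this (-a) (by simpa using han) (neg_ne_zero.2 ha) (by simpa using hab) (by omega)
      obtain ⟨b', hb', hbb⟩ : ∃ b' : ℤ, 2 * |b'| ≤ a ∧ a ∣ b' - b := by
        refine ⟨Int.bmod b a.natAbs, ?_, ?_⟩
        · have h1 := Int.bmod_le (x := b) (m := a.natAbs) (by omega)
          have h2 := Int.le_bmod (x := b) (m := a.natAbs) (by omega)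
          rcases abs_cases (Int.bmod b a.natAbs) with h | h <;> omega
        · have := Int.dvd_bmod_sub_self (x := b) (m := a.natAbs)
          simpa using this
      rw [← quadIdeal_congr θ hbb]
      have hab' : a ∣ b' ^ 2 - d := by
        have : b' ^ 2 - d = (b' - b) * (b' + b) + (b ^ 2 - d) := by ring
        rw [this]
        exact dvd_add (hbb.mul_right _) hab
      by_cases hle : a ^ 2 ≤ |b' ^ 2 - d|
      · exact hred a b' hpos hb' hab' hle
      · obtain ⟨c, hc⟩ := hab'
        have hc0 : c ≠ 0 := by
          rintro rfl
          exact hd b' (by linarith)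
        rw [idealClass_quadIdeal_swap hθ ha hc0 hc.symm]
        refine ih c.natAbs ?_ c (-b') rfl hc0 ⟨a, by linear_combination hc⟩
        rw [hc, abs_mul, abs_of_pos hpos, sq, mul_le_mul_iff_right₀ hpos] at hle
        have := le_abs_self a
        rw [← han, ← Int.ofNat_lt, Int.natCast_natAbs, Int.natCast_natAbs]
        omega
  obtain ⟨⟨J, hJ⟩, rfl⟩ := ClassGroup.mk0_surjective C
  have hJ0 : J ≠ ⊥ := nonZeroDivisors.ne_zero hJ
  obtain ⟨n, a, b, hn, ha, hab, h⟩ := exists_eq_span_mul_quadIdeal hθ hgen hd hJ0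
  have hJc : idealClass J = ClassGroup.mk0 ⟨J, hJ⟩ := by rw [idealClass, dif_neg hJ0]
  rw [← hJc, h, idealClass_mul (by simpa using hn) (quadIdeal_ne_bot θ ha b),
    idealClass_span_singleton, one_mul]
  exact key _ a b rfl ha hab

theorem idealClass_quadIdeal_two_sq {θ : R} {d : ℤ} (hθ : θ ^ 2 = d) (hd : d % 4 = 2) :
    idealClass (quadIdeal θ 2 0) ^ 2 = 1 := by
  obtain ⟨k, rfl⟩ : ∃ k, d = 2 * (2 * k + 1) := ⟨d / 4, by omega⟩
  have h := idealClass_quadIdeal_mul hθ (a := 2) (a' := -(2 * k + 1)) (b := 0) (by omega)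
    (by omega) ⟨1, by ring⟩ ⟨k + 1, 1, 0, by ring⟩
  have hs := idealClass_quadIdeal_swap hθ (a := 2) (b := 0) (c := -(2 * k + 1)) (by omega)
    (by omega) (by ring)
  rw [neg_zero] at hs
  rw [← hs, ← sq] at h
  rw [← h]
  have := quadIdeal_eq_span hθ 0
  rw [show (2 : ℤ) * -(2 * k + 1) = 0 ^ 2 - 2 * (2 * k + 1) by ring, this,
    idealClass_span_singleton]

theorem idealClass_quadIdeal_sq_mul {θ : R} {d : ℤ} (hθ : θ ^ 2 = d) {p r : ℤ} (hp : Odd p)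
    (hpr : IsCoprime p r) (hr : Even r) (h : r ^ 2 - d = 2 * p ^ 2) :
    idealClass (quadIdeal θ p r) ^ 2 * idealClass (quadIdeal θ 2 0) = 1 := by
  have hp0 : p ≠ 0 := by rintro rfl; simp at hp
  obtain ⟨u, v, huv⟩ : IsCoprime p (2 * r) :=
    IsCoprime.mul_right (Int.isCoprime_iff_gcd_eq_one.2 (by
      simpa [Int.gcd_comm] using Int.isCoprime_iff_gcd_eq_one.1
        (Int.isCoprime_two_left.2 hp).symm)) hpr
  obtain ⟨k, hk⟩ := hp
  have h1 := idealClass_quadIdeal_mul hθ hp0 hp0 (b := r) ⟨2, by linear_combination h⟩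
    ⟨u, 0, v, by linear_combination huv⟩
  have h2 := idealClass_quadIdeal_mul hθ (mul_ne_zero hp0 hp0) two_ne_zero (b := r)
    ⟨1, by linear_combination h⟩
    ⟨1, -(2 * k ^ 2 + 2 * k), 0, by rw [hk]; ring⟩
  rw [← quadIdeal_congr θ (a := 2) (b := 0) (b' := r) (by simpa using hr.two_dvd), sq, ← h1, ← h2,
    show p * p * 2 = r ^ 2 - d by linear_combination -h, quadIdeal_eq_span hθ,
    idealClass_span_singleton]

theorem nonempty_classGroup_mulEquiv_zmod_four {θ : R} {d : ℤ} (hθ : θ ^ 2 = d)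
    (hgen : ∀ x : R, ∃ a b : ℤ, x = a + b * θ)
    (hinj : ∀ a b : ℤ, (a : R) + b * θ = 0 → a = 0 ∧ b = 0) (hd : d % 4 = 2)
    (hnorm : ∀ x y : ℤ, (x ^ 2 - d * y ^ 2).natAbs ≠ 2)
    {p r : ℤ} (hp : Odd p) (hpr : IsCoprime p r) (hr : Even r) (h : r ^ 2 - d = 2 * p ^ 2)
    (hred : ∀ a b : ℤ, 0 < a → 2 * |b| ≤ a → a ∣ b ^ 2 - d → a ^ 2 ≤ |b ^ 2 - d| →
      idealClass (quadIdeal θ a b) ∈ Subgroup.zpowers (idealClass (quadIdeal θ p r))) :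
    Nonempty (ClassGroup R ≃* Multiplicative (ZMod 4)) := by
  have hall := mem_of_forall_reduced hθ hgen (sq_ne_of_emod_four hd) hred
  have h1 := idealClass_quadIdeal_sq_mul hθ hp hpr hr h
  have h2 := idealClass_quadIdeal_two_sq hθ hd
  have h3 : idealClass (quadIdeal θ 2 0) ≠ 1 := by
    rw [Ne, idealClass_eq_one_iff (quadIdeal_ne_bot θ two_ne_zero 0)]
    exact not_isPrincipal_quadIdeal_two hθ hgen hinj hd hnorm
  set g := idealClass (quadIdeal θ p r)
  have hord : orderOf g = 2 ^ (1 + 1) := by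
    refine orderOf_eq_prime_pow (fun h0 ↦ h3 ?_) ?_
    · rw [pow_one] at h0
      rwa [h0, one_mul] at h1
    · rw [eq_inv_of_mul_eq_one_right h1, inv_pow, inv_eq_one, ← pow_mul] at h2
      exact h2
  have hcyc : IsCyclic (ClassGroup R) := ⟨g, hall⟩
  have hcard : Nat.card (ClassGroup R) = 4 := by
    rw [← orderOf_eq_card_of_forall_mem_zpowers hall, hord]; norm_num
  exact ⟨(hcard ▸ zmodCyclicMulEquiv hcyc).symm⟩

end QuadraticOrder

section QuadraticField

theorem exists_intCast_eq_of_sq_mul {d : ℤ} (hd : Squarefree d) {r : ℚ} {n : ℤ}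
    (h : d * r ^ 2 = n) : ∃ k : ℤ, r = k := by
  have hden : (r.den : ℚ) ≠ 0 := by exact_mod_cast r.den_nz
  have h1 : d * r.num ^ 2 = n * (r.den : ℤ) ^ 2 := by
    have h2 : (d : ℚ) * r.num ^ 2 = n * (r.den : ℚ) ^ 2 := by
      rw [← h, ← Rat.mul_den_eq_num]; ring
    exact_mod_cast h2
  have hcop : IsCoprime ((r.den : ℤ) ^ 2) (r.num ^ 2) :=
    (Int.isCoprime_iff_gcd_eq_one.2 (by simpa [Int.gcd, Nat.Coprime] using r.reduced.symm)).pow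
  have h3 : (r.den : ℤ) * r.den ∣ d := by
    rw [← sq]
    exact hcop.dvd_of_dvd_mul_right ⟨n, by linear_combination h1⟩
  have h4 := hd _ h3
  have h5 : r.den = 1 := by simpa [Int.isUnit_iff_natAbs_eq] using h4
  exact ⟨r.num, ((Rat.den_eq_one_iff r).1 h5).symm⟩

theorem exists_trace_norm_of_isIntegral {K : Type*} [Field K] [CharZero K] {t x : K} {d : ℤ}
    (ht : t ^ 2 = d) (hd : ∀ b : ℤ, b ^ 2 ≠ d) {a b : ℚ} (hx : x = a + b * t)
    (hint : IsIntegral ℤ x) : ∃ m n : ℤ, 2 * a = m ∧ a ^ 2 - d * b ^ 2 = n := by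
  by_cases hb : b = 0
  · subst hb
    have : IsIntegral ℤ a := by
      rw [← isIntegral_algebraMap_iff (algebraMap ℚ K).injective]
      simpa [hx] using hint
    obtain ⟨k, hk⟩ := IsIntegrallyClosed.isIntegral_iff.1 this
    refine ⟨2 * k, k ^ 2, ?_, ?_⟩ <;> simp [← hk]
  · have hintQ : IsIntegral ℚ x := hint.tower_top
    let f : ℚ[X] := X ^ 2 - C (2 * a) * X + C (a ^ 2 - d * b ^ 2)
    have hfm : f.Monic := by unfold f; monicity!
    have hfd : f.natDegree = 2 := by unfold f; compute_degree!
    have hdvd : minpoly ℚ x ∣ f := by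
      refine minpoly.dvd ℚ x ?_
      simp [f, hx]
      linear_combination (b : K) ^ 2 * ht
    have hrange : x ∉ (algebraMap ℚ K).range := by
      rintro ⟨q, hq⟩
      have hbK : (b : K) ≠ 0 := by exact_mod_cast hb
      have htq : t = ((q - a) / b : ℚ) := by
        push_cast
        rw [eq_div_iff hbK]
        rw [hx, eq_ratCast] at hq
        linear_combination -hq
      have hsq : ((q - a) / b) ^ 2 = (d : ℚ) := by
        rw [htq] at ht
        exact_mod_cast ht
      obtain ⟨k, hk⟩ : IsSquare d :=
        Rat.isSquare_intCast_iff.1 ⟨(q - a) / b, by rw [← hsq, sq]⟩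
      exact hd k (by rw [hk, sq])
    have hmin : minpoly ℚ x = f := by
      refine (Polynomial.eq_of_monic_of_dvd_of_natDegree_le (minpoly.monic hintQ) hfm hdvd ?_).symm
      rw [hfd]
      exact (minpoly.two_le_natDegree_iff hintQ).2 hrange
    rw [minpoly.isIntegrallyClosed_eq_field_fractions' ℚ hint] at hmin
    have h0 := congrArg (fun p ↦ p.coeff 0) hmin
    have h1 := congrArg (fun p ↦ p.coeff 1) hmin
    simp only [f, coeff_map, coeff_add, coeff_sub, coeff_X_pow, coeff_C_mul, coeff_X,
      coeff_C] at h0 h1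
    norm_num at h0 h1
    exact ⟨-(minpoly ℤ x).coeff 1, (minpoly ℤ x).coeff 0, by push_cast; linarith, h0.symm⟩

theorem exists_int_of_isIntegral {K : Type*} [Field K] [CharZero K] {t x : K} {d : ℤ}
    (ht : t ^ 2 = d) (hd : d % 4 = 2) (hsf : Squarefree d) {a b : ℚ} (hx : x = a + b * t)
    (hint : IsIntegral ℤ x) : ∃ m n : ℤ, x = m + n * t := by
  obtain ⟨m, n, hm, hn⟩ := exists_trace_norm_of_isIntegral ht (sq_ne_of_emod_four hd) hx hint
  obtain ⟨k, hk⟩ := exists_intCast_eq_of_sq_mul hsf (r := 2 * b) (n := m ^ 2 - 4 * n) (by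
    push_cast; rw [← hm, ← hn]; ring)
  have h : m ^ 2 - d * k ^ 2 = 4 * n := by
    have : (m : ℚ) ^ 2 - d * k ^ 2 = 4 * n := by rw [← hm, ← hn, ← hk]; ring
    exact_mod_cast this
  obtain ⟨e, rfl⟩ : ∃ e, d = 4 * e + 2 := ⟨d / 4, by omega⟩
  obtain ⟨m', rfl | rfl⟩ := Int.even_or_odd' m
  · obtain ⟨k', rfl | rfl⟩ := Int.even_or_odd' k
    · refine ⟨m', k', ?_⟩
      have ha : a = m' := by push_cast at hm; linarith
      have hb : b = k' := by push_cast at hk; linarith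
      rw [hx, ha, hb]; push_cast; rfl
    · ring_nf at h; omega
  · have : (4 * e + 2) * k ^ 2 = 2 * ((2 * e + 1) * k ^ 2) := by ring
    rw [this] at h
    ring_nf at h; omega

theorem exists_rat_of_mem_adjoin {L : Type*} [Field L] [CharZero L] {α : L} {d : ℤ}
    (hα : α ^ 2 = d) {x : L} (hx : x ∈ ℚ⟮α⟯) : ∃ a b : ℚ, x = a + b * α := by
  have hint : IsIntegral ℚ α := ⟨X ^ 2 - C (d : ℚ), by monicity!, by
    rw [eval₂_sub, eval₂_pow, eval₂_X, eval₂_C, hα]; simp⟩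
  rw [← mem_toSubalgebra, adjoin_simple_toSubalgebra_of_isAlgebraic hint.isAlgebraic] at hx
  induction hx using Algebra.adjoin_induction with
  | mem y hy => exact ⟨0, 1, by simpa using hy⟩
  | algebraMap r => exact ⟨r, 0, by simp⟩
  | add y z _ _ hy hz =>
    obtain ⟨a, b, rfl⟩ := hy
    obtain ⟨a', b', rfl⟩ := hz
    exact ⟨a + a', b + b', by push_cast; ring⟩
  | mul y z _ _ hy hz =>
    obtain ⟨a, b, rfl⟩ := hy
    obtain ⟨a', b', rfl⟩ := hz
    exact ⟨a * a' + d * b * b', a * b' + b * a', by push_cast; linear_combination b * b' * hα⟩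

/-- For squarefree `d ≡ 2 mod 4`, the ring of integers of `ℚ(√d)` is `ℤ[√d]`. -/
theorem exists_ringOfIntegers_basis {L : Type*} [Field L] [CharZero L] {α : L} {d : ℤ}
    (hα : α ^ 2 = d) (hd : d % 4 = 2) (hsf : Squarefree d) :
    ∃ θ : 𝓞 ℚ⟮α⟯, θ ^ 2 = d ∧ (∀ x : 𝓞 ℚ⟮α⟯, ∃ a b : ℤ, x = a + b * θ) ∧
      ∀ a b : ℤ, (a : 𝓞 ℚ⟮α⟯) + b * θ = 0 → a = 0 ∧ b = 0 := by
  let t : ℚ⟮α⟯ := AdjoinSimple.gen ℚ α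
  have ht : t ^ 2 = d := Subtype.ext (by simpa [t] using hα)
  have hti : IsIntegral ℤ t := ⟨X ^ 2 - C d, by monicity!, by
    rw [eval₂_sub, eval₂_pow, eval₂_X, eval₂_C, ht]; simp⟩
  let θ : 𝓞 ℚ⟮α⟯ := ⟨t, hti⟩
  have hθt : (θ : ℚ⟮α⟯) = t := rfl
  have hθ : θ ^ 2 = d := RingOfIntegers.ext (by simpa [hθt] using ht)
  refine ⟨θ, hθ, fun x ↦ ?_, fun a b h ↦ ?_⟩
  · obtain ⟨a, b, hab⟩ := exists_rat_of_mem_adjoin hα (x : ℚ⟮α⟯).2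
    obtain ⟨m, n, hmn⟩ := exists_int_of_isIntegral ht hd hsf (x := (x : ℚ⟮α⟯)) (a := a) (b := b)
      (Subtype.ext (by simpa [t] using hab)) x.2
    exact ⟨m, n, RingOfIntegers.ext (by simpa [hθt] using hmn)⟩
  · have h1 : a ^ 2 = d * b ^ 2 := by
      have : (a : 𝓞 ℚ⟮α⟯) ^ 2 = d * b ^ 2 := by
        linear_combination (a - b * θ) * h + (b : 𝓞 ℚ⟮α⟯) ^ 2 * hθ
      exact_mod_cast this
    have hb : b = 0 := by
      by_contra hb
      obtain ⟨c, rfl⟩ : b ∣ a := (Int.pow_dvd_pow_iff two_ne_zero).1 ⟨d, by linarith⟩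
      exact sq_ne_of_emod_four hd c (mul_left_cancel₀ (pow_ne_zero 2 hb) (by linarith))
    subst hb
    exact ⟨by simpa using h1, rfl⟩

end QuadraticField

section Reduced

theorem int_sq_sub_mul_sq_natAbs_ne_two (x y : ℤ) : (x ^ 2 - 82 * y ^ 2).natAbs ≠ 2 := by
  suffices H : ∀ (n : ℕ) (x y : ℤ), 0 ≤ x → y.natAbs = n → 0 ≤ y →
      (x ^ 2 - 82 * y ^ 2).natAbs ≠ 2 by
    simpa using H _ |x| |y| (abs_nonneg x) rfl (abs_nonneg y)
  intro n
  induction n using Nat.strong_induction_on with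
  | _ n ih =>
    intro x y hx hyn hy h
    rcases hy.eq_or_lt with rfl | hy
    · have h' : x ^ 2 = 2 := by
        rw [zero_pow two_ne_zero, mul_zero, sub_zero] at h
        have := sq_nonneg x
        omega
      have : x ≤ 1 := by nlinarith
      interval_cases x <;> omega
    · have h1 : x ^ 2 - 82 * y ^ 2 = 2 ∨ x ^ 2 - 82 * y ^ 2 = -2 := Int.natAbs_eq_iff.1 h
      have hlo : 8 * y < x := by rcases h1 with h1 | h1 <;> nlinarith
      have hhi : x < 10 * y := by rcases h1 with h1 | h1 <;> nlinarith
      refine ih (9 * y - x).natAbs (by omega) |9 * x - 82 * y| |9 * y - x| (abs_nonneg _)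
        (Int.natAbs_abs _) (abs_nonneg _) ?_
      rw [sq_abs, sq_abs, show (9 * x - 82 * y) ^ 2 - 82 * (9 * y - x) ^ 2 =
        -(x ^ 2 - 82 * y ^ 2) by ring, Int.natAbs_neg, h]

variable {R : Type*} [CommRing R] [IsDedekindDomain R] [CharZero R]

theorem idealClass_mem_zpowers_of_sq_eq_82 {θ : R} (hθ : θ ^ 2 = (82 : ℤ)) {a b : ℤ} (ha : 0 < a)
    (hb : 2 * |b| ≤ a) (hdvd : a ∣ b ^ 2 - 82) (hle : a ^ 2 ≤ |b ^ 2 - 82|) :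
    idealClass (quadIdeal θ a b) ∈ Subgroup.zpowers (idealClass (quadIdeal θ 3 10)) := by
  have h1 := idealClass_quadIdeal_sq_mul hθ (p := 3) (r := 10) (by decide)
    (by norm_num) (by decide) (by norm_num)
  have hcongr : quadIdeal θ 3 10 = quadIdeal θ 3 1 := quadIdeal_congr θ (by norm_num)
  rw [hcongr] at h1 ⊢
  set g := idealClass (quadIdeal θ 3 1) with hg
  have hgm : g ∈ Subgroup.zpowers g := Subgroup.mem_zpowers g
  have m2 : idealClass (quadIdeal θ 2 0) ∈ Subgroup.zpowers g := by
    rw [eq_inv_of_mul_eq_one_right h1]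
    exact inv_mem (pow_mem hgm 2)
  have m9 : idealClass (quadIdeal θ 9 1) ∈ Subgroup.zpowers g := by
    rw [show (9 : ℤ) = 3 * 3 by norm_num, idealClass_quadIdeal_mul hθ (by norm_num) (by norm_num)
      (by norm_num) ⟨1, 0, -1, by norm_num⟩]
    exact mul_mem hgm hgm
  have m3 : idealClass (quadIdeal θ 3 (-1)) ∈ Subgroup.zpowers g := by
    rw [idealClass_quadIdeal_swap hθ (c := -(9 * 3)) (by norm_num) (by norm_num) (by norm_num),
      quadIdeal_neg, neg_neg, idealClass_quadIdeal_mul hθ (by norm_num) (by norm_num)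
      (by norm_num) ⟨1, -2, -1, by norm_num⟩]
    exact mul_mem m9 hgm
  have m6 : ∀ b : ℤ, 2 ∣ b → (6 : ℤ) ∣ b ^ 2 - 82 →
      idealClass (quadIdeal θ 3 b) ∈ Subgroup.zpowers g →
      idealClass (quadIdeal θ 6 b) ∈ Subgroup.zpowers g := by
    intro b hb h6 h
    rw [show (6 : ℤ) = 2 * 3 by norm_num, idealClass_quadIdeal_mul hθ (by norm_num) (by norm_num)
      (by simpa using h6) ⟨-1, 1, 0, by norm_num⟩, quadIdeal_congr θ (b := 0) (by simpa using hb)]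
    exact mul_mem m2 h
  have hbb := abs_le.1 (show |b| ≤ a / 2 by omega)
  have ha9 : a ≤ 9 := by
    have : 4 * b ^ 2 ≤ a ^ 2 := by
      rw [← sq_abs b]; nlinarith [abs_nonneg b]
    rcases abs_cases (b ^ 2 - 82) with h | h <;> nlinarith
  have hcases : a = 1 ∨ (a = 2 ∧ b = 0) ∨ (a = 3 ∧ (b = 1 ∨ b = -1)) ∨
      (a = 6 ∧ (b = 2 ∨ b = -2)) ∨ (a = 9 ∧ (b = 1 ∨ b = -1)) := by
    clear * - ha ha9 hbb hdvd
    obtain ⟨hb1, hb2⟩ := hbb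
    interval_cases a <;> norm_num at hb1 hb2 <;> interval_cases b <;> revert hdvd <;> decide
  rcases hcases with rfl | ⟨rfl, rfl⟩ | ⟨rfl, rfl | rfl⟩ | ⟨rfl, rfl | rfl⟩ | ⟨rfl, rfl | rfl⟩
  · rw [quadIdeal_one, ← Ideal.span_singleton_one, idealClass_span_singleton]
    exact one_mem _
  · exact m2
  · exact hgm
  · exact m3
  · exact m6 2 (by decide) (by decide) (by rwa [quadIdeal_congr θ (b := -1) (by decide)])
  · exact m6 (-2) (by decide) (by decide) (by rwa [quadIdeal_congr θ (b := 1) (by decide)])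
  · exact m9
  · rwa [idealClass_quadIdeal_swap hθ (c := -9) (by decide) (by decide) (by decide),
      quadIdeal_neg]

theorem idealClass_mem_zpowers_of_sq_eq_neg_82 {θ : R} (hθ : θ ^ 2 = (-82 : ℤ)) {a b : ℤ}
    (ha : 0 < a) (hb : 2 * |b| ≤ a) (hdvd : a ∣ b ^ 2 - -82) (hle : a ^ 2 ≤ |b ^ 2 - -82|) :
    idealClass (quadIdeal θ a b) ∈ Subgroup.zpowers (idealClass (quadIdeal θ 7 4)) := by
  have h1 := idealClass_quadIdeal_sq_mul hθ (p := 7) (r := 4) (by decide)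
    (by norm_num) (by decide) (by norm_num)
  set g := idealClass (quadIdeal θ 7 4) with hg
  have hgm : g ∈ Subgroup.zpowers g := Subgroup.mem_zpowers g
  have m2 : idealClass (quadIdeal θ 2 0) ∈ Subgroup.zpowers g := by
    rw [eq_inv_of_mul_eq_one_right h1]
    exact inv_mem (pow_mem hgm 2)
  have m7 : idealClass (quadIdeal θ 7 3) ∈ Subgroup.zpowers g := by
    rw [quadIdeal_congr θ (b := -4) (by decide),
      idealClass_quadIdeal_swap hθ (c := 2 * 7) (by norm_num) (by norm_num) (by norm_num),
      neg_neg, idealClass_quadIdeal_mul hθ (by norm_num) (by norm_num)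
      (by norm_num) ⟨-3, 1, 0, by norm_num⟩, quadIdeal_congr θ (b := 0) (by decide)]
    exact mul_mem m2 hgm
  have hbb := abs_le.1 (show |b| ≤ a / 2 by omega)
  have ha10 : a ≤ 10 := by
    have : 4 * b ^ 2 ≤ a ^ 2 := by
      rw [← sq_abs b]; nlinarith [abs_nonneg b]
    rw [abs_of_nonneg (by nlinarith [sq_nonneg b])] at hle
    nlinarith
  have hcases : a = 1 ∨ (a = 2 ∧ b = 0) ∨ (a = 7 ∧ (b = 3 ∨ b = -3)) := by
    clear * - ha ha10 hbb hdvd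
    obtain ⟨hb1, hb2⟩ := hbb
    interval_cases a <;> norm_num at hb1 hb2 <;> interval_cases b <;> revert hdvd <;> decide
  rcases hcases with rfl | ⟨rfl, rfl⟩ | ⟨rfl, rfl | rfl⟩
  · rw [quadIdeal_one, ← Ideal.span_singleton_one, idealClass_span_singleton]
    exact one_mem _
  · exact m2
  · exact m7
  · rwa [quadIdeal_congr θ (b := 4) (by decide)]

end Reduced

/-- The ideal class group of the ring of integers of `ℚ(√82)` is isomorphic to
`ℤ/4ℤ`, and the ideal class group of the ring of integers of `ℚ(√-82)` is also
isomorphic to `ℤ/4ℤ`. -/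
theorem classGroup_sqrt82_and_sqrt_neg82 :
    Nonempty (ClassGroup (𝓞 ℚ⟮Real.sqrt (82 : ℕ)⟯) ≃* Multiplicative (ZMod 4)) ∧
    Nonempty (ClassGroup (𝓞 ℚ⟮(Real.sqrt (82 : ℕ) : ℂ) * Complex.I⟯) ≃*
      Multiplicative (ZMod 4)) := by
  have hsf : Squarefree (82 : ℤ) := by
    rw [← Int.squarefree_natAbs]
    rw [show (82 : ℤ).natAbs = 2 * 41 from rfl, Nat.squarefree_mul (by norm_num)]
    exact ⟨Nat.prime_two.prime.squarefree, (by norm_num : Nat.Prime 41).prime.squarefree⟩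
  constructor
  · obtain ⟨θ, hθ, hgen, hinj⟩ := exists_ringOfIntegers_basis (α := √((82 : ℕ) : ℝ)) (d := 82)
      (by simp) (by decide) hsf
    exact nonempty_classGroup_mulEquiv_zmod_four hθ hgen hinj (by decide)
      int_sq_sub_mul_sq_natAbs_ne_two (p := 3) (r := 10) (by decide) (by norm_num) (by decide)
      (by norm_num) fun _ _ ↦ idealClass_mem_zpowers_of_sq_eq_82 hθ
  · obtain ⟨θ, hθ, hgen, hinj⟩ := exists_ringOfIntegers_basis
      (α := (√((82 : ℕ) : ℝ) : ℂ) * Complex.I) (d := -82)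
      (by rw [mul_pow, Complex.I_sq, ← Complex.ofReal_pow, Real.sq_sqrt (by positivity)]; simp)
      (by decide) (by rwa [← Int.squarefree_natAbs, Int.natAbs_neg, Int.squarefree_natAbs])
    refine nonempty_classGroup_mulEquiv_zmod_four hθ hgen hinj (by decide) (fun x y h ↦ ?_)
      (p := 7) (r := 4) (by decide) (by norm_num) (by decide)
      (by norm_num) fun _ _ ↦ idealClass_mem_zpowers_of_sq_eq_neg_82 hθ
    have h2 : x ^ 2 + 82 * y ^ 2 = 2 := by
      have := sq_nonneg x
      have := sq_nonneg y
      rw [neg_mul, sub_neg_eq_add] at h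
      omega
    have hy : y = 0 := by
      by_contra hy
      have : 1 ≤ y ^ 2 := Int.add_one_le_iff.2 (sq_pos_of_ne_zero hy)
      nlinarith [sq_nonneg x]
    subst hy
    exact int_sq_sub_mul_sq_natAbs_ne_two x 0 (by simp_all)
end

section
/- The polynomial x⁴ - 2x³ + 4x² - 8x + 16 is irreducible over ℚ, and it remains irreducible over the real quadratic field ℚ(√82). -/
open IntermediateField Polynomial

/-- Over a field of characteristic other than two in which `5` is not a square, the polynomial
`x⁴ - 2x³ + 4x² - 8x + 16` is irreducible. -/
theorem irreducible_quartic_of_forall_sq_ne_five {K : Type*} [Field K] (h2 : (2 : K) ≠ 0)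
    (h5 : ∀ y : K, y ^ 2 ≠ 5) :
    Irreducible (X ^ 4 - 2 * X ^ 3 + 4 * X ^ 2 - 8 * X + 16 : K[X]) := by
  have hC : (X ^ 4 - 2 * X ^ 3 + 4 * X ^ 2 - 8 * X + 16 : K[X]) =
      X ^ 4 + C (-2) * X ^ 3 + C 4 * X ^ 2 + C (-8) * X + C 16 := by
    simp only [map_neg, map_ofNat]; ring
  rw [hC]
  set p : K[X] := X ^ 4 + C (-2) * X ^ 3 + C 4 * X ^ 2 + C (-8) * X + C 16 with hp
  have hdeg : p.natDegree = 4 := by rw [hp]; compute_degree!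
  have hmonic : p.Monic := by rw [hp]; monicity!
  rw [hmonic.irreducible_iff_natDegree']
  refine ⟨fun h => by simp [h] at hdeg, fun f g hf hg hfg hmem => ?_⟩
  have hsum : f.natDegree + g.natDegree = 4 := by rw [← hf.natDegree_mul hg, hfg, hdeg]
  rw [hdeg, Finset.mem_Ioc] at hmem
  obtain hg1 | hg2 : g.natDegree = 1 ∨ g.natDegree = 2 := by omega
  · set r : K := -g.coeff 0
    have hr : p.eval r = 0 := by
      rw [← hfg, hg.eq_X_add_C hg1]
      simp [r]
    simp only [hp, eval_add, eval_mul, eval_pow, eval_X, eval_C] at hr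
    have hr0 : r ≠ 0 := by
      intro h0
      apply pow_ne_zero 4 h2
      rw [h0] at hr
      linear_combination hr
    apply h5 (r + 4 / r - 1)
    field_simp
    linear_combination hr
  · have hf2 : f.natDegree = 2 := by omega
    have hf' := hf.as_sum
    have hg' := hg.as_sum
    rw [hf2] at hf'
    rw [hg2] at hg'
    simp only [Finset.sum_range_succ, Finset.sum_range_zero, zero_add, pow_zero, mul_one,
      pow_one] at hf' hg'
    generalize f.coeff 0 = b at hf'
    generalize f.coeff 1 = a at hf'
    generalize g.coeff 0 = d at hg'
    generalize g.coeff 1 = c at hg'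
    have hprod : X ^ 4 + C (a + c) * X ^ 3 + C (b + d + a * c) * X ^ 2 + C (a * d + b * c) * X +
        C (b * d) = p := by
      rw [← hfg, hf', hg']
      simp only [map_add, map_mul]
      ring
    have e3 := congrArg (coeff · 3) hprod
    have e2 := congrArg (coeff · 2) hprod
    have e1 := congrArg (coeff · 1) hprod
    have e0 := congrArg (coeff · 0) hprod
    simp [hp, coeff_X, coeff_C, -map_add, -map_mul, -map_neg] at e3 e2 e1 e0
    have hac : (a - c) ^ 2 = 4 * (b + d) - 12 := by linear_combination (a + c - 2) * e3 - 4 * e2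
    have hbd : (b - d) ^ 2 = (b + d) ^ 2 - 64 := by linear_combination -4 * e0
    have hmul : (a - c) * (b - d) = 16 - 2 * (b + d) := by
      linear_combination (b + d) * e3 - 2 * e1
    have hfac : 2 ^ 2 * ((b + d - 8) * ((b + d + 2) ^ 2 - 20)) = 0 := by
      linear_combination -(b - d) ^ 2 * hac - (4 * (b + d) - 12) * hbd +
        ((a - c) * (b - d) + 16 - 2 * (b + d)) * hmul
    rcases mul_eq_zero.1 ((mul_eq_zero.1 hfac).resolve_left (pow_ne_zero 2 h2)) with h | h
    · apply h5 ((a - c) / 2)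
      field_simp
      linear_combination hac + 4 * h
    · apply h5 ((b + d + 2) / 2)
      field_simp
      linear_combination h

/-- Every element of `ℚ(√n)` is of the form `p + q√n` with `p` and `q` rational. -/
theorem exists_eq_add_mul_sqrt_of_mem_adjoin (n : ℕ) {x : ℝ} (hx : x ∈ ℚ⟮Real.sqrt n⟯) :
    ∃ p q : ℚ, x = p + q * Real.sqrt n := by
  rw [← mem_toSubalgebra, adjoin_simple_toSubalgebra_of_isAlgebraic
    (sqrtNat_isIntegral n).isAlgebraic] at hx
  induction hx using Algebra.adjoin_induction with
  | mem x hx => exact ⟨0, 1, by simpa using hx⟩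
  | algebraMap r => exact ⟨r, 0, by simp⟩
  | add x y _ _ hx hy =>
    obtain ⟨p, q, rfl⟩ := hx
    obtain ⟨s, t, rfl⟩ := hy
    exact ⟨p + s, q + t, by push_cast; ring⟩
  | mul x y _ _ hx hy =>
    obtain ⟨p, q, rfl⟩ := hx
    obtain ⟨s, t, rfl⟩ := hy
    refine ⟨p * s + n * q * t, p * t + q * s, ?_⟩
    push_cast
    linear_combination (q * t : ℝ) * Real.sq_sqrt (Nat.cast_nonneg (α := ℝ) n)

/-- A natural number that is not a perfect square is not the square of a rational number. -/
theorem Rat.sq_ne_natCast {n : ℕ} (hn : ¬IsSquare n) (y : ℚ) : y ^ 2 ≠ n := fun h =>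
  hn (Rat.isSquare_natCast_iff.1 ⟨y, by rw [← h, sq]⟩)

/-- `5` is not a square in `ℚ(√82)`. -/
theorem sq_ne_five_of_adjoin_sqrt82 (y : ℚ⟮Real.sqrt 82⟯) : y ^ 2 ≠ 5 := by
  intro hy
  have hyR : (y : ℝ) ^ 2 = 5 := congrArg (algebraMap ℚ⟮Real.sqrt 82⟯ ℝ) hy |>.trans (map_ofNat _ 5)
  obtain ⟨p, q, hpq⟩ := exists_eq_add_mul_sqrt_of_mem_adjoin 82 y.2
  have hs : Real.sqrt (82 : ℕ) ^ 2 = 82 := by norm_num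
  have hirr : Irrational (Real.sqrt (82 : ℕ)) :=
    irrational_sqrt_natCast_iff.2 (by decide +kernel)
  rw [hpq] at hyR
  have hlin : ((5 - p ^ 2 - 82 * q ^ 2 : ℚ) : ℝ) = (2 * p * q : ℚ) * Real.sqrt (82 : ℕ) := by
    push_cast at hyR hs ⊢
    linear_combination -hyR + (q : ℝ) ^ 2 * hs
  by_cases h : 2 * p * q = 0
  · rw [h, Rat.cast_zero, zero_mul, Rat.cast_eq_zero] at hlin
    rcases mul_eq_zero.1 h with h | h
    · have hp : p = 0 := by linarith
      apply Rat.sq_ne_natCast (n := 410) (by decide +kernel) (82 * q)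
      subst hp
      push_cast
      linear_combination -82 * hlin
    · apply Rat.sq_ne_natCast (n := 5) (by decide +kernel) p
      subst h
      push_cast
      linear_combination -hlin
  · exact (hirr.ratCast_mul h).ne_rat _ hlin.symm

/-- The polynomial `x⁴ - 2x³ + 4x² - 8x + 16` is irreducible over `ℚ`, and it remains
irreducible over the real quadratic field `ℚ(√82)`. -/
theorem irreducible_poly_over_rat_and_over_sqrt82 :
    Irreducible (X ^ 4 - 2 * X ^ 3 + 4 * X ^ 2 - 8 * X + 16 : ℚ[X]) ∧
    Irreducible ((X ^ 4 - 2 * X ^ 3 + 4 * X ^ 2 - 8 * X + 16 : ℚ[X]).map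
      (algebraMap ℚ ℚ⟮Real.sqrt 82⟯)) := by
  refine ⟨irreducible_quartic_of_forall_sq_ne_five two_ne_zero fun y => ?_, ?_⟩
  · exact_mod_cast Rat.sq_ne_natCast (n := 5) (by decide +kernel) y
  · simpa using irreducible_quartic_of_forall_sq_ne_five two_ne_zero sq_ne_five_of_adjoin_sqrt82
end
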